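/- arXiv:2602.10792 — 3 statements merged into one kernel-verified Lean document; each statement's English description precedes it below -/
import Mathlib

section
/- Let (Ω, F, P) be a probability space, let s : Ω → ℝ^d be a random vector with law μ, let n be a standard Gaussian vector on ℝ^d independent of s, let η > 0, and set z := s + η n. For every bounded measurable f : ℝ^d → ℝ define g(w) := (∫ f(x) exp(−‖w − x‖²/(2η²)) dμ(x)) / (∫ exp(−‖w − x‖²/(2η²)) dμ(x)); the denominator is strictly positive for every w ∈ ℝ^d. Then g(z) is a version of the conditional expectation of f(s) given z, i.e. E[f(s) | σ(z)] = g(z) almost surely. -/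
open Matrix Real MeasureTheory ProbabilityTheory

open scoped NNReal ENNReal

/-- Bayes' formula: if `(s, z)` has density `k` with respect to `μ.prod ν`, the conditional
expectation of `f s` given `z` is the `k`-weighted average of `f`. -/
theorem condExp_comp_ae_eq_of_map_prodMk_eq_withDensity {Ω X Y : Type*} [MeasurableSpace Ω]
    [MeasurableSpace X] [MeasurableSpace Y] {P : Measure Ω} [IsProbabilityMeasure P]
    {μ : Measure X} [SFinite μ] {ν : Measure Y} [SFinite ν]
    {s : Ω → X} {z : Ω → Y} (hs : Measurable s) (hz : Measurable z)
    {k : X × Y → ℝ} (hk : Measurable k) (hk_nonneg : ∀ p, 0 ≤ k p)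
    (hk_int : ∀ y, Integrable (fun x => k (x, y)) μ) (hk_pos : ∀ y, 0 < ∫ x, k (x, y) ∂μ)
    (hlaw : P.map (fun ω => (s ω, z ω)) = (μ.prod ν).withDensity fun p => ENNReal.ofReal (k p))
    {f : X → ℝ} (hf : Measurable f) {C : ℝ} (hC : ∀ x, |f x| ≤ C) :
    P[(fun ω => f (s ω)) | MeasurableSpace.comap z inferInstance]
      =ᵐ[P] fun ω => (∫ x, f x * k (x, z ω) ∂μ) / ∫ x, k (x, z ω) ∂μ := by
  set g : Y → ℝ := fun y => (∫ x, f x * k (x, y) ∂μ) / ∫ x, k (x, y) ∂μ with hg_def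
  have hsz : Measurable fun ω => (s ω, z ω) := hs.prodMk hz
  have hg : Measurable g := by
    have h₁ : StronglyMeasurable fun p : X × Y => f p.1 * k p :=
      ((hf.comp measurable_fst).mul hk).stronglyMeasurable
    exact h₁.integral_prod_left'.measurable.div hk.stronglyMeasurable.integral_prod_left'.measurable
  have hg_bound (y : Y) : |g y| ≤ C := by
    simp only [hg_def]
    rw [abs_div, abs_of_pos (hk_pos y), div_le_iff₀ (hk_pos y), ← integral_const_mul]
    refine norm_integral_le_of_norm_le (G := ℝ) ((hk_int y).const_mul C) (ae_of_all _ fun x => ?_)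
    rw [norm_mul, Real.norm_eq_abs, Real.norm_of_nonneg (hk_nonneg _)]
    exact mul_le_mul_of_nonneg_right (hC x) (hk_nonneg _)
  have hk_prod : Integrable k (μ.prod ν) := by
    refine ⟨hk.aestronglyMeasurable, ?_⟩
    rw [hasFiniteIntegral_iff_ofReal (ae_of_all _ hk_nonneg)]
    have h := congrArg (fun m => m Set.univ) hlaw
    simp only [withDensity_apply _ MeasurableSet.univ, Measure.restrict_univ] at h
    rw [← h]
    have := Measure.isProbabilityMeasure_map (μ := P) hsz.aemeasurable
    exact measure_lt_top _ _
  have integrable_mul {F : X × Y → ℝ} (hF : Measurable F) (hFC : ∀ p, |F p| ≤ C) :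
      Integrable (fun p => k p * F p) (μ.prod ν) :=
    hk_prod.mul_bdd (c := C) hF.aestronglyMeasurable (ae_of_all _ hFC)
  have setIntegral_eq {F : X × Y → ℝ} (hF : Measurable F) (hFC : ∀ p, |F p| ≤ C)
      {A : Set Y} (hA : MeasurableSet A) :
      ∫ ω in z ⁻¹' A, F (s ω, z ω) ∂P = ∫ y in A, ∫ x, k (x, y) * F (x, y) ∂μ ∂ν := by
    have hA' : MeasurableSet (Prod.snd ⁻¹' A : Set (X × Y)) := measurable_snd hA
    change ∫ ω in (fun ω => (s ω, z ω)) ⁻¹' (Prod.snd ⁻¹' A), F (s ω, z ω) ∂P = _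
    rw [← setIntegral_map hA' hF.aestronglyMeasurable hsz.aemeasurable, hlaw,
      setIntegral_withDensity_eq_setIntegral_toReal_smul₀ (by fun_prop)
        (ae_of_all _ fun _ => ENNReal.ofReal_lt_top) _ hA', ← Set.univ_prod,
      ← Measure.prod_restrict, Measure.restrict_univ]
    simp_rw [ENNReal.toReal_ofReal (hk_nonneg _), smul_eq_mul]
    refine integral_prod_symm _ ?_
    rw [← Measure.restrict_univ (μ := μ), Measure.prod_restrict]
    exact (integrable_mul hF hFC).integrableOn
  refine (ae_eq_condExp_of_forall_setIntegral_eq hz.comap_le ?_ ?_ ?_ ?_).symm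
  · exact .of_bound (hf.comp hs).aestronglyMeasurable C (ae_of_all _ fun ω => hC _)
  · intro t _ _
    exact (Integrable.of_bound (hg.comp hz).aestronglyMeasurable C
      (ae_of_all _ fun ω => hg_bound _)).integrableOn
  · rintro _ ⟨A, hA, rfl⟩ _
    rw [setIntegral_eq (F := fun p => g p.2) (hg.comp measurable_snd) (fun _ => hg_bound _) hA,
      setIntegral_eq (F := fun p => f p.1) (hf.comp measurable_fst) (fun _ => hC _) hA]
    refine integral_congr_ae (ae_of_all _ fun y => ?_)
    simp only [integral_mul_const, hg_def]
    rw [mul_div_cancel₀ _ (hk_pos y).ne']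
    simp_rw [mul_comm]
  · exact (hg.comp (comap_measurable z)).aestronglyMeasurable

/-- A product of nondegenerate Gaussian measures has the product of the densities as density. -/
theorem pi_gaussianReal_eq_withDensity {ι : Type*} [Fintype ι] (m : ι → ℝ) {v : ℝ≥0}
    (hv : v ≠ 0) :
    (Measure.pi fun i => gaussianReal (m i) v)
      = volume.withDensity fun w => ENNReal.ofReal (∏ i, gaussianPDFReal (m i) v (w i)) := by
  refine Measure.pi_eq fun t ht => ?_
  have hint (i : ι) : Integrable (gaussianPDFReal (m i) v) (volume.restrict (t i)) :=
    (integrable_gaussianPDFReal _ _).integrableOn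
  rw [withDensity_apply _ (.univ_pi ht), volume_pi, Measure.restrict_pi_pi,
    ← ofReal_integral_eq_lintegral_ofReal (Integrable.fintype_prod hint)
      (ae_of_all _ fun w => Finset.prod_nonneg fun i _ => gaussianPDFReal_nonneg _ _ _),
    integral_fintype_prod_eq_prod, ENNReal.ofReal_prod_of_nonneg fun i _ =>
      integral_nonneg fun x => gaussianPDFReal_nonneg _ _ _]
  simp_rw [gaussianReal_apply_eq_integral _ hv]

/-- The density of `x + η n` for a standard Gaussian vector `n`. -/
theorem map_add_smul_pi_gaussianReal {ι : Type*} [Fintype ι] (x : ι → ℝ) {η : ℝ} (hη : 0 < η) :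
    (Measure.pi fun _ : ι => gaussianReal 0 1).map (fun y => x + η • y)
      = volume.withDensity fun w => ENNReal.ofReal
          ((√(2 * π * η ^ 2))⁻¹ ^ Fintype.card ι
            * Real.exp (-((w - x) ⬝ᵥ (w - x)) / (2 * η ^ 2))) := by
  have hmap (i : ι) : (gaussianReal 0 1).map (fun y => x i + η * y)
      = gaussianReal (x i) (.mk (η ^ 2) (sq_nonneg η)) := by
    have h := Measure.map_map (μ := gaussianReal 0 1) (measurable_const_add (x i))
      (measurable_const_mul η)
    rw [gaussianReal_map_const_mul, gaussianReal_map_const_add] at h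
    simpa [Function.comp_def] using h.symm
  have hv : NNReal.mk (η ^ 2) (sq_nonneg η) ≠ 0 := by
    rw [Ne, ← NNReal.coe_eq_zero]
    exact (pow_pos hη 2).ne'
  have (i : ι) : SigmaFinite ((gaussianReal 0 1).map (fun y => x i + η * y)) := by
    rw [hmap]; infer_instance
  have hpi := Measure.pi_map_pi (μ := fun _ : ι => gaussianReal 0 1)
    (f := fun i y => x i + η * y) fun i => by fun_prop
  simp_rw [hmap, pi_gaussianReal_eq_withDensity x hv] at hpi
  refine hpi.trans ?_
  congr with w
  simp_rw [gaussianPDFReal, Finset.prod_mul_distrib, Finset.prod_const, ← Real.exp_sum,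
    dotProduct, ← Finset.sum_div, Finset.sum_neg_distrib, Pi.sub_apply, ← sq]
  rfl

/-- The joint law of a signal and its noisy observation, when the noise transition has density. -/
theorem map_prodMk_eq_withDensity_prod {X Y Z : Type*} [MeasurableSpace X] [MeasurableSpace Y]
    [MeasurableSpace Z] {μ : Measure X} [SFinite μ] {γ : Measure Y} [SFinite γ]
    {ν : Measure Z} [SFinite ν] {T : X × Y → Z} (hT : Measurable T)
    {k : X × Z → ℝ≥0∞} (hk : Measurable k)
    (h : ∀ x, γ.map (fun y => T (x, y)) = ν.withDensity fun w => k (x, w)) :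
    (μ.prod γ).map (fun p => (p.1, T p)) = (μ.prod ν).withDensity k := by
  ext S hS
  have hS' : Measurable fun p : X × Y => (p.1, T p) := measurable_fst.prodMk hT
  rw [Measure.map_apply hS' hS, Measure.prod_apply (hS' hS), withDensity_apply _ hS,
    ← lintegral_indicator hS, lintegral_prod _ (hk.indicator hS).aemeasurable]
  refine lintegral_congr fun x => ?_
  have hSx : MeasurableSet (Prod.mk x ⁻¹' S) := measurable_prodMk_left hS
  have := congrArg (fun m => m (Prod.mk x ⁻¹' S)) (h x)
  rw [Measure.map_apply (by fun_prop) hSx, withDensity_apply _ hSx,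
    ← lintegral_indicator hSx] at this
  exact this

/-- Denoising posterior: if `s ~ μ`, `n` an independent standard Gaussian on `ℝ^d`,
`z = s + η n`, then for bounded measurable `f`, the function
`g(w) = (∫ f(x) e^{−‖w−x‖²/(2η²)} dμ(x)) / (∫ e^{−‖w−x‖²/(2η²)} dμ(x))`
(whose denominator is strictly positive) satisfies `E[f(s) | σ(z)] = g(z)` a.s. -/
theorem stmt_4 {Ω : Type*} [MeasurableSpace Ω] (P : Measure Ω) [IsProbabilityMeasure P]
    (d : ℕ) (μ : Measure (Fin d → ℝ)) [IsProbabilityMeasure μ]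
    (s n : Ω → Fin d → ℝ) (hs : Measurable s) (hn : Measurable n)
    (hlaw_s : P.map s = μ)
    (hlaw_n : P.map n = Measure.pi fun _ : Fin d => gaussianReal 0 1)
    (hindep : IndepFun s n P)
    (η : ℝ) (hη : 0 < η)
    (z : Ω → Fin d → ℝ) (hz : z = fun ω => s ω + η • n ω)
    (f : (Fin d → ℝ) → ℝ) (hf : Measurable f) (hfb : ∃ C, ∀ x, |f x| ≤ C)
    (g : (Fin d → ℝ) → ℝ)
    (hg : ∀ w, g w
      = (∫ x, f x * Real.exp (-((w - x) ⬝ᵥ (w - x)) / (2 * η ^ 2)) ∂μ)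
        / (∫ x, Real.exp (-((w - x) ⬝ᵥ (w - x)) / (2 * η ^ 2)) ∂μ)) :
    (∀ w : Fin d → ℝ, 0 < ∫ x, Real.exp (-((w - x) ⬝ᵥ (w - x)) / (2 * η ^ 2)) ∂μ) ∧
      P[(fun ω => f (s ω)) | MeasurableSpace.comap z inferInstance]
        =ᵐ[P] fun ω => g (z ω) := by
  obtain ⟨C, hC⟩ := hfb
  have hk_meas : Measurable fun p : (Fin d → ℝ) × (Fin d → ℝ) =>
      Real.exp (-((p.2 - p.1) ⬝ᵥ (p.2 - p.1)) / (2 * η ^ 2)) := by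
    unfold dotProduct
    fun_prop
  have hk_int (w : Fin d → ℝ) :
      Integrable (fun x => Real.exp (-((w - x) ⬝ᵥ (w - x)) / (2 * η ^ 2))) μ := by
    refine .of_bound (hk_meas.comp measurable_prodMk_right).aestronglyMeasurable 1
      (ae_of_all _ fun x => ?_)
    rw [Real.norm_of_nonneg (Real.exp_nonneg _), Real.exp_le_one_iff]
    exact div_nonpos_of_nonpos_of_nonneg
      (neg_nonpos.2 (Finset.sum_nonneg fun i _ => mul_self_nonneg _)) (by positivity)
  have hpos (w : Fin d → ℝ) :
      0 < ∫ x, Real.exp (-((w - x) ⬝ᵥ (w - x)) / (2 * η ^ 2)) ∂μ :=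
    integral_exp_pos (hk_int w)
  refine ⟨hpos, ?_⟩
  set c : ℝ := (√(2 * π * η ^ 2))⁻¹ ^ Fintype.card (Fin d)
  have hc : 0 < c := by positivity
  have hT : Measurable fun p : (Fin d → ℝ) × (Fin d → ℝ) => p.1 + η • p.2 := by fun_prop
  have hlaw : P.map (fun ω => (s ω, z ω)) = (μ.prod volume).withDensity fun p =>
      ENNReal.ofReal (c * Real.exp (-((p.2 - p.1) ⬝ᵥ (p.2 - p.1)) / (2 * η ^ 2))) := by
    rw [← map_prodMk_eq_withDensity_prod hT (hk_meas.const_mul c).ennreal_ofReal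
      fun x => map_add_smul_pi_gaussianReal x hη, ← hlaw_n, ← hlaw_s,
      ← (indepFun_iff_map_prod_eq_prod_map_map hs.aemeasurable hn.aemeasurable).1 hindep,
      Measure.map_map (measurable_fst.prodMk hT) (hs.prodMk hn), hz]
    rfl
  refine (condExp_comp_ae_eq_of_map_prodMk_eq_withDensity hs (by rw [hz]; fun_prop)
    (hk_meas.const_mul c) (fun p => by positivity) (fun w => (hk_int w).const_mul c)
    (fun w => ?_) hlaw hf hC).trans (ae_of_all _ fun ω => ?_)
  · rw [integral_const_mul]
    exact mul_pos hc (hpos w)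
  · simp only [mul_left_comm _ c, integral_const_mul, hg]
    rw [mul_div_mul_left _ _ hc.ne']
end

section
/- Let (Ω, F, P) be a probability space, let s : Ω → ℝⁿ be a random vector with law μ, let H be an m×n real matrix, let n₀ be a standard Gaussian vector on ℝ^m independent of s, let σ > 0, and set y := H s + σ n₀. For every bounded measurable f : ℝⁿ → ℝ define g(w) := (∫ f(x) exp(−‖w − H x‖²/(2σ²)) dμ(x)) / (∫ exp(−‖w − H x‖²/(2σ²)) dμ(x)); the denominator is strictly positive for every w ∈ ℝ^m. Then E[f(s) | σ(y)] = g(y) almost surely. -/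
open Matrix Real MeasureTheory ProbabilityTheory

open scoped ENNReal

/-- **Tonelli's theorem** for a product of functions of one coordinate each. -/
theorem lintegral_fin_prod_eq_prod {k : ℕ} {E : Fin k → Type*}
    {mE : ∀ i, MeasurableSpace (E i)} (ν : ∀ i, Measure (E i)) [∀ i, SigmaFinite (ν i)]
    {d : ∀ i, E i → ℝ≥0∞} (hd : ∀ i, Measurable (d i)) :
    ∫⁻ x, ∏ i, d i (x i) ∂(Measure.pi ν) = ∏ i, ∫⁻ x, d i x ∂(ν i) := by
  induction k with
  | zero => simp
  | succ k ih =>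
    have hmp := (measurePreserving_piFinSuccAbove ν 0).symm
    rw [← hmp.lintegral_comp_emb (MeasurableEquiv.measurableEmbedding _)]
    simp_rw [Fin.prod_univ_succ]
    refine Eq.trans ?_ (congrArg _ (ih (fun i => ν i.succ) (fun i => hd i.succ)))
    exact lintegral_prod_mul (μ := ν 0) (ν := Measure.pi fun i : Fin k => ν i.succ) (f := d 0)
      (g := fun x : ∀ i : Fin k, E i.succ => ∏ i, d i.succ (x i))
      (hd 0).aemeasurable (Finset.measurable_prod _ fun i _ =>
        (hd i.succ).comp (measurable_pi_apply i)).aemeasurable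

/-- A product of measures with densities has the product of the densities as its density. -/
theorem pi_withDensity_eq_withDensity_prod {k : ℕ} {E : Fin k → Type*}
    {mE : ∀ i, MeasurableSpace (E i)} (ν : ∀ i, Measure (E i)) [∀ i, SigmaFinite (ν i)]
    {d : ∀ i, E i → ℝ≥0∞} (hd : ∀ i, Measurable (d i))
    [∀ i, SigmaFinite ((ν i).withDensity (d i))] :
    Measure.pi (fun i => (ν i).withDensity (d i))
      = (Measure.pi ν).withDensity (fun x => ∏ i, d i (x i)) := by
  refine Measure.pi_eq fun t ht => ?_
  rw [withDensity_apply _ (MeasurableSet.univ_pi ht), Measure.restrict_pi_pi,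
    lintegral_fin_prod_eq_prod _ hd]
  exact Finset.prod_congr rfl fun i _ => (withDensity_apply _ (ht i)).symm

/-- The density of the Gaussian law on `ℝ^k` with mean `c` and covariance `σ² I`. -/
theorem map_const_add_smul_pi_gaussianReal {k : ℕ} (c : Fin k → ℝ) {σ : ℝ} (hσ : 0 < σ) :
    (Measure.pi fun _ : Fin k => gaussianReal 0 1).map (fun z => c + σ • z)
      = volume.withDensity (fun w => ENNReal.ofReal
          ((√(2 * π * σ ^ 2))⁻¹ ^ k * rexp (-((w - c) ⬝ᵥ (w - c)) / (2 * σ ^ 2)))) := by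
  set v : NNReal := ⟨σ ^ 2, sq_nonneg σ⟩
  have hv0 : v ≠ 0 := by
    rw [← NNReal.coe_ne_zero]
    exact (pow_pos hσ 2).ne'
  have hcoord (i : Fin k) :
      (gaussianReal 0 1).map (fun t => c i + σ * t) = volume.withDensity (gaussianPDF (c i) v) := by
    have hcomp : (fun t => c i + σ * t) = (fun t => c i + t) ∘ (fun t => σ * t) := rfl
    rw [hcomp, ← Measure.map_map (by fun_prop) (by fun_prop), gaussianReal_map_const_mul,
      gaussianReal_map_const_add, ← gaussianReal_of_var_ne_zero _ hv0]
    simp only [mul_zero, zero_add, mul_one]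
    rfl
  have hprob (i : Fin k) : IsProbabilityMeasure ((gaussianReal 0 1).map (fun t => c i + σ * t)) :=
    Measure.isProbabilityMeasure_map (by fun_prop)
  have hprob' (i : Fin k) :
      IsProbabilityMeasure ((volume : Measure ℝ).withDensity (gaussianPDF (c i) v)) :=
    hcoord i ▸ hprob i
  have hmap := Measure.pi_map_pi (μ := fun _ : Fin k => gaussianReal 0 1)
    (f := fun i t => c i + σ * t) (fun i => by fun_prop)
  simp_rw [hcoord] at hmap
  rw [pi_withDensity_eq_withDensity_prod _ (fun i => measurable_gaussianPDF (c i) v)] at hmap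
  refine hmap.trans ?_
  rw [← volume_pi]
  congr 1
  ext w
  simp only [gaussianPDF]
  rw [← ENNReal.ofReal_prod_of_nonneg fun i _ => gaussianPDFReal_nonneg _ _ _]
  simp only [gaussianPDFReal, Finset.prod_mul_distrib, ← Real.exp_sum, Finset.prod_const,
    Finset.card_univ, Fintype.card_fin, ← Finset.sum_div, Finset.sum_neg_distrib, dotProduct,
    Pi.sub_apply, ← pow_two]
  rfl

/-- If `(s, y)` has density `ℓ` with respect to `μ ⊗ ν`, then conditional expectations given `y`
are computed by Bayes' formula. -/
theorem condExp_comp_eq_div_of_map_prodMk_eq_withDensity {Ω X Y : Type*}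
    [MeasurableSpace Ω] [MeasurableSpace X] [MeasurableSpace Y]
    {P : Measure Ω} [IsProbabilityMeasure P]
    {μ : Measure X} [SFinite μ] {ν : Measure Y} [SFinite ν]
    {s : Ω → X} {y : Ω → Y} (hs : Measurable s) (hy : Measurable y)
    {l : X → Y → ℝ} (hl : Measurable (Function.uncurry l)) (hl0 : ∀ x w, 0 ≤ l x w)
    (hlpos : ∀ w, 0 < ∫ x, l x w ∂μ)
    (hmap : P.map (fun ω => (s ω, y ω))
      = (μ.prod ν).withDensity (fun p => ENNReal.ofReal (l p.1 p.2)))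
    {f : X → ℝ} (hf : Measurable f) {C : ℝ} (hfC : ∀ x, |f x| ≤ C) :
    P[(fun ω => f (s ω)) | MeasurableSpace.comap y inferInstance]
      =ᵐ[P] fun ω => (∫ x, f x * l x (y ω) ∂μ) / (∫ x, l x (y ω) ∂μ) := by
  set g : Y → ℝ := fun w => (∫ x, f x * l x w ∂μ) / (∫ x, l x w ∂μ) with hg
  have hl' : Measurable fun p : X × Y => l p.1 p.2 := hl
  have hli (w : Y) : Integrable (fun x => l x w) μ := by
    by_contra h
    exact (hlpos w).ne' (integral_undef h)
  have hgm : Measurable g := by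
    refine Measurable.div ?_ ?_
    · exact (StronglyMeasurable.integral_prod_left' (μ := μ) (f := fun p : X × Y => f p.1 * l p.1 p.2)
        ((hf.comp measurable_fst).mul hl').stronglyMeasurable).measurable
    · exact (StronglyMeasurable.integral_prod_left' (μ := μ) (f := fun p : X × Y => l p.1 p.2)
        hl'.stronglyMeasurable).measurable
  have hgC (w : Y) : |g w| ≤ C := by
    rw [hg, abs_div, abs_of_pos (hlpos w), div_le_iff₀ (hlpos w), ← integral_const_mul,
      ← Real.norm_eq_abs]
    refine norm_integral_le_of_norm_le ((hli w).const_mul C) (ae_of_all _ fun x => ?_)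
    rw [norm_mul, Real.norm_of_nonneg (hl0 x w)]
    exact mul_le_mul_of_nonneg_right (hfC x) (hl0 x w)
  have hint {F : X × Y → ℝ} (hF : Measurable F) (hFC : ∀ p, |F p| ≤ C) {B : Set Y}
      (hB : MeasurableSet B) :
      ∫ ω in y ⁻¹' B, F (s ω, y ω) ∂P = ∫ w in B, ∫ x, F (x, w) * l x w ∂μ ∂ν := by
    have hpair : Measurable fun ω => (s ω, y ω) := hs.prodMk hy
    have hFi : Integrable F (P.map fun ω => (s ω, y ω)) := by
      have := Measure.isProbabilityMeasure_map (μ := P) hpair.aemeasurable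
      exact Integrable.of_bound hF.aestronglyMeasurable C (ae_of_all _ hFC)
    rw [hmap, integrable_withDensity_iff (by fun_prop) (by simp)] at hFi
    have hset : y ⁻¹' B = (fun ω => (s ω, y ω)) ⁻¹' (Set.univ ×ˢ B) := by
      ext; simp
    rw [hset, ← setIntegral_map (MeasurableSet.univ.prod hB) hF.aestronglyMeasurable
      hpair.aemeasurable, hmap, setIntegral_withDensity_eq_setIntegral_toReal_smul
      (by fun_prop) (by simp) _ (MeasurableSet.univ.prod hB), ← Measure.prod_restrict,
      Measure.restrict_univ, integral_prod_symm]
    · simp [ENNReal.toReal_ofReal (hl0 _ _), mul_comm]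
    · have := hFi.mono_measure (Measure.restrict_le_self (s := Set.univ ×ˢ B))
      rw [← Measure.prod_restrict, Measure.restrict_univ] at this
      simpa [mul_comm] using this
  refine (ae_eq_condExp_of_forall_setIntegral_eq hy.comap_le ?_ ?_ ?_ ?_).symm
  · exact Integrable.of_bound (hf.comp hs).aestronglyMeasurable C (ae_of_all _ fun ω => hfC _)
  · exact fun t _ _ => (Integrable.of_bound (hgm.comp hy).aestronglyMeasurable C
      (ae_of_all _ fun ω => hgC _)).integrableOn
  · rintro _ ⟨B, hB, rfl⟩ -
    rw [hint (F := fun p => g p.2) (by fun_prop) (fun p => hgC _) hB,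
      hint (F := fun p => f p.1) (by fun_prop) (fun p => hfC _) hB]
    congr 1
    ext w
    dsimp only
    rw [integral_const_mul, hg, div_mul_cancel₀ _ (hlpos w).ne']
  · exact (hgm.comp (comap_measurable y)).aestronglyMeasurable

/-- Bayesian posterior for a linear-Gaussian observation model: if `s ~ μ` on `ℝⁿ`,
`n₀` an independent standard Gaussian on `ℝ^m`, `y = H s + σ n₀`, then for bounded
measurable `f`, the function
`g(w) = (∫ f(x) e^{−‖w−Hx‖²/(2σ²)} dμ(x)) / (∫ e^{−‖w−Hx‖²/(2σ²)} dμ(x))`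
(whose denominator is strictly positive) satisfies `E[f(s) | σ(y)] = g(y)` a.s. -/
theorem stmt_5 {Ω : Type*} [MeasurableSpace Ω] (P : Measure Ω) [IsProbabilityMeasure P]
    (m n : ℕ) (μ : Measure (Fin n → ℝ)) [IsProbabilityMeasure μ]
    (s : Ω → Fin n → ℝ) (n₀ : Ω → Fin m → ℝ)
    (hs : Measurable s) (hn₀ : Measurable n₀)
    (hlaw_s : P.map s = μ)
    (hlaw_n₀ : P.map n₀ = Measure.pi fun _ : Fin m => gaussianReal 0 1)
    (hindep : IndepFun s n₀ P)
    (H : Matrix (Fin m) (Fin n) ℝ) (σ : ℝ) (hσ : 0 < σ)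
    (y : Ω → Fin m → ℝ) (hy : y = fun ω => H.mulVec (s ω) + σ • n₀ ω)
    (f : (Fin n → ℝ) → ℝ) (hf : Measurable f) (hfb : ∃ C, ∀ x, |f x| ≤ C)
    (g : (Fin m → ℝ) → ℝ)
    (hg : ∀ w, g w
      = (∫ x, f x
            * Real.exp (-((w - H.mulVec x) ⬝ᵥ (w - H.mulVec x)) / (2 * σ ^ 2)) ∂μ)
        / (∫ x, Real.exp (-((w - H.mulVec x) ⬝ᵥ (w - H.mulVec x)) / (2 * σ ^ 2)) ∂μ)) :
    (∀ w : Fin m → ℝ,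
        0 < ∫ x, Real.exp (-((w - H.mulVec x) ⬝ᵥ (w - H.mulVec x)) / (2 * σ ^ 2)) ∂μ) ∧
      P[(fun ω => f (s ω)) | MeasurableSpace.comap y inferInstance]
        =ᵐ[P] fun ω => g (y ω) := by
  have hcont (w : Fin m → ℝ) : Measurable fun x : Fin n → ℝ =>
      rexp (-((w - H.mulVec x) ⬝ᵥ (w - H.mulVec x)) / (2 * σ ^ 2)) := by
    simp only [dotProduct, mulVec, Pi.sub_apply]
    fun_prop
  have hpos (w : Fin m → ℝ) :
      0 < ∫ x, rexp (-((w - H.mulVec x) ⬝ᵥ (w - H.mulVec x)) / (2 * σ ^ 2)) ∂μ := by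
    refine integral_exp_pos (Integrable.of_bound (hcont w).aestronglyMeasurable 1
      (ae_of_all _ fun x => ?_))
    rw [Real.norm_of_nonneg (exp_pos _).le, Real.exp_le_one_iff]
    have h : 0 ≤ (w - H.mulVec x) ⬝ᵥ (w - H.mulVec x) :=
      Finset.sum_nonneg fun i _ => mul_self_nonneg _
    exact div_nonpos_of_nonpos_of_nonneg (neg_nonpos.2 h) (by positivity)
  refine ⟨hpos, ?_⟩
  obtain ⟨C, hC⟩ := hfb
  set K : ℝ := (√(2 * π * σ ^ 2))⁻¹ ^ m
  have hKpos : 0 < K := by positivity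
  set l : (Fin n → ℝ) → (Fin m → ℝ) → ℝ := fun x w =>
    K * rexp (-((w - H.mulVec x) ⬝ᵥ (w - H.mulVec x)) / (2 * σ ^ 2)) with hldef
  have hl : Measurable (Function.uncurry l) := by
    simp only [Function.uncurry_def, l, dotProduct, mulVec, Pi.sub_apply]
    fun_prop
  have hl' : Measurable fun p : (Fin n → ℝ) × (Fin m → ℝ) => l p.1 p.2 := hl
  have hHs : Measurable fun x : Fin n → ℝ => H.mulVec x := by
    refine measurable_pi_lambda _ fun i => ?_
    simp only [mulVec, dotProduct]
    fun_prop
  have hym : Measurable y := by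
    rw [hy]
    exact (hHs.comp hs).add (hn₀.const_smul σ)
  have hmap : P.map (fun ω => (s ω, y ω))
      = (μ.prod volume).withDensity (fun p => ENNReal.ofReal (l p.1 p.2)) := by
    have hprod := (indepFun_iff_map_prod_eq_prod_map_map hs.aemeasurable hn₀.aemeasurable).1 hindep
    rw [hlaw_s, hlaw_n₀] at hprod
    have hT : Measurable fun p : (Fin n → ℝ) × (Fin m → ℝ) => (p.1, H.mulVec p.1 + σ • p.2) :=
      measurable_fst.prodMk ((hHs.comp measurable_fst).add (measurable_snd.const_smul σ))
    have hcomp : (fun ω => (s ω, y ω))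
        = (fun p : (Fin n → ℝ) × (Fin m → ℝ) => (p.1, H.mulVec p.1 + σ • p.2))
          ∘ fun ω => (s ω, n₀ ω) := by
      rw [hy]
      rfl
    rw [hcomp, ← Measure.map_map hT (hs.prodMk hn₀), hprod]
    ext A hA
    rw [Measure.map_apply hT hA, Measure.prod_apply (hT hA), withDensity_apply _ hA,
      ← lintegral_indicator hA,
      lintegral_prod _ ((hl'.ennreal_ofReal.indicator hA).aemeasurable)]
    refine lintegral_congr fun x => ?_
    have hAx : MeasurableSet (Prod.mk x ⁻¹' A) := measurable_prodMk_left hA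
    have hd := congrArg (fun ρ : Measure (Fin m → ℝ) => ρ (Prod.mk x ⁻¹' A))
      (map_const_add_smul_pi_gaussianReal (H.mulVec x) hσ)
    rw [Measure.map_apply (by fun_prop) hAx, withDensity_apply _ hAx,
      ← lintegral_indicator hAx] at hd
    exact hd
  have hlpos (w : Fin m → ℝ) : 0 < ∫ x, l x w ∂μ := by
    rw [hldef, integral_const_mul]
    exact mul_pos hKpos (hpos w)
  refine (condExp_comp_eq_div_of_map_prodMk_eq_withDensity hs hym hl
    (fun x w => mul_nonneg hKpos.le (exp_pos _).le) hlpos hmap hf hC).trans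
    (ae_of_all _ fun ω => ?_)
  simp only [hg, hldef, mul_left_comm (f _) K, integral_const_mul]
  exact mul_div_mul_left _ _ hKpos.ne'
end

section
/- Let μ be a Borel probability measure on ℝ^d and let η > 0. Define p(z) := ∫_{ℝ^d} exp(−‖z − x‖²/(2η²)) dμ(x) (which is strictly positive and differentiable on ℝ^d) and define the posterior mean m(z) := (∫_{ℝ^d} x · exp(−‖z − x‖²/(2η²)) dμ(x)) / p(z). Then Tweedie's formula holds: for every z ∈ ℝ^d, ∇ log p(z) = (m(z) − z)/η², i.e. η² · ∇p(z)/p(z) = m(z) − z. -/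
open Real MeasureTheory

lemma integrable_exp_neg_norm_sub_sq {E : Type*} [NormedAddCommGroup E] [MeasurableSpace E]
    [BorelSpace E] [SecondCountableTopology E] (μ : Measure E) [IsFiniteMeasure μ]
    (η : ℝ) (z : E) :
    Integrable (fun x => Real.exp (-‖z - x‖ ^ 2 / (2 * η ^ 2))) μ := by
  refine Integrable.of_bound (by fun_prop) 1 (.of_forall fun x => ?_)
  rw [Real.norm_of_nonneg (Real.exp_pos _).le, Real.exp_le_one_iff, neg_div]
  exact neg_nonpos.mpr (by positivity)

section GaussianKernel

variable {E : Type*} [NormedAddCommGroup E] [InnerProductSpace ℝ E]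

/-- A Gaussian-weighted displacement is bounded by the standard deviation. -/
lemma norm_exp_smul_sub_le {η : ℝ} (hη : 0 < η) (z x : E) :
    ‖Real.exp (-‖z - x‖ ^ 2 / (2 * η ^ 2)) • (x - z)‖ ≤ η := by
  rw [norm_smul, Real.norm_of_nonneg (Real.exp_pos _).le, norm_sub_rev x z, neg_div,
    Real.exp_neg, inv_mul_le_iff₀ (Real.exp_pos _)]
  set t := ‖z - x‖
  have h_exp := Real.add_one_le_exp (t ^ 2 / (2 * η ^ 2))
  have h_amgm : t ≤ (t ^ 2 / (2 * η ^ 2) + 1) * η := by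
    have h_eq : (t ^ 2 / (2 * η ^ 2) + 1) * η - t = ((t - η) ^ 2 + η ^ 2) / (2 * η) := by
      field_simp
      ring
    have h_nonneg : 0 ≤ ((t - η) ^ 2 + η ^ 2) / (2 * η) := by positivity
    linarith
  exact h_amgm.trans (by gcongr)

lemma hasGradientAt_exp_neg_norm_sub_sq [CompleteSpace E] {η : ℝ} (hη : 0 < η) (z x : E) :
    HasGradientAt (fun z => Real.exp (-‖z - x‖ ^ 2 / (2 * η ^ 2)))
      ((η ^ 2)⁻¹ • Real.exp (-‖z - x‖ ^ 2 / (2 * η ^ 2)) • (x - z)) z := by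
  rw [hasGradientAt_iff_hasFDerivAt]
  have h := ((((hasFDerivAt_id z).sub_const x).norm_sq.neg).mul_const (2 * η ^ 2)⁻¹).exp
  simp only [id, ← div_eq_mul_inv] at h
  refine h.congr_fderiv ?_
  ext v
  simp
  field_simp
  ring

variable [MeasurableSpace E] [BorelSpace E] [SecondCountableTopology E]
  (μ : Measure E) [IsFiniteMeasure μ]

lemma integrable_exp_smul_sub {η : ℝ} (hη : 0 < η) (z : E) :
    Integrable (fun x => Real.exp (-‖z - x‖ ^ 2 / (2 * η ^ 2)) • (x - z)) μ :=
  Integrable.of_bound (by fun_prop) η (.of_forall (norm_exp_smul_sub_le hη z))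

/-- Differentiation under the integral sign for a Gaussian convolution. -/
lemma hasGradientAt_integral_exp_neg_norm_sub_sq [CompleteSpace E] {η : ℝ} (hη : 0 < η) (z : E) :
    HasGradientAt (fun z => ∫ x, Real.exp (-‖z - x‖ ^ 2 / (2 * η ^ 2)) ∂μ)
      ((η ^ 2)⁻¹ • ∫ x, Real.exp (-‖z - x‖ ^ 2 / (2 * η ^ 2)) • (x - z) ∂μ) z := by
  have h := hasFDerivAt_integral_of_dominated_of_fderiv_le (𝕜 := ℝ) (μ := μ)
    (F := fun z x => Real.exp (-‖z - x‖ ^ 2 / (2 * η ^ 2)))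
    (F' := fun z x => InnerProductSpace.toDual ℝ E
      ((η ^ 2)⁻¹ • Real.exp (-‖z - x‖ ^ 2 / (2 * η ^ 2)) • (x - z)))
    (x₀ := z) (bound := fun _ => (η ^ 2)⁻¹ * η) Filter.univ_mem
    (.of_forall fun z => (integrable_exp_neg_norm_sub_sq μ η z).aestronglyMeasurable)
    (integrable_exp_neg_norm_sub_sq μ η z)
    ((InnerProductSpace.toDual ℝ E).continuous.comp_aestronglyMeasurable
      ((integrable_exp_smul_sub μ hη z).smul _).aestronglyMeasurable)
    (.of_forall fun x w _ => by
      rw [LinearIsometryEquiv.norm_map, norm_smul, Real.norm_of_nonneg (by positivity)]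
      gcongr
      exact norm_exp_smul_sub_le hη w x)
    (integrable_const _)
    (.of_forall fun x w _ => (hasGradientAt_exp_neg_norm_sub_sq hη w x).hasFDerivAt)
  rw [hasGradientAt_iff_hasFDerivAt, ← integral_smul]
  refine h.congr_fderiv ?_
  exact ContinuousLinearMap.integral_comp_commSL (by simp)
    ((InnerProductSpace.toDual ℝ E).toContinuousLinearEquiv : E →L⋆[ℝ] StrongDual ℝ E)
    ((integrable_exp_smul_sub μ hη z).smul (η ^ 2)⁻¹)

end GaussianKernel


/-- Tweedie's formula: with `p(z) = ∫ exp(−‖z − x‖²/(2η²)) dμ(x)` (strictly positive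
and differentiable) and posterior mean
`m(z) = (∫ x exp(−‖z − x‖²/(2η²)) dμ(x)) / p(z)`, the score satisfies
`∇ log p(z) = (m(z) − z)/η²`, i.e. `η² ∇p(z)/p(z) = m(z) − z` for every `z`. -/
theorem stmt_14 (d : ℕ) (μ : Measure (EuclideanSpace ℝ (Fin d)))
    [IsProbabilityMeasure μ] (η : ℝ) (hη : 0 < η)
    (p : EuclideanSpace ℝ (Fin d) → ℝ)
    (hp : p = fun z => ∫ x, Real.exp (-‖z - x‖ ^ 2 / (2 * η ^ 2)) ∂μ)
    (mz : EuclideanSpace ℝ (Fin d) → EuclideanSpace ℝ (Fin d))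
    (hm : mz = fun z => (p z)⁻¹ • ∫ x, Real.exp (-‖z - x‖ ^ 2 / (2 * η ^ 2)) • x ∂μ) :
    ∀ z, 0 < p z ∧ DifferentiableAt ℝ p z ∧
      (η ^ 2) • (p z)⁻¹ • gradient p z = mz z - z := by
  intro z
  have h_int := integrable_exp_neg_norm_sub_sq μ η z
  have h_pos : 0 < p z := by
    rw [hp]
    exact integral_exp_pos h_int
  have h_grad : HasGradientAt p _ z := hp ▸ hasGradientAt_integral_exp_neg_norm_sub_sq μ hη z
  refine ⟨h_pos, h_grad.differentiableAt, ?_⟩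
  have h_split : ∫ x, Real.exp (-‖z - x‖ ^ 2 / (2 * η ^ 2)) • x ∂μ =
      ∫ x, Real.exp (-‖z - x‖ ^ 2 / (2 * η ^ 2)) • (x - z) ∂μ + p z • z := by
    rw [hp, ← integral_smul_const,
      ← integral_add (integrable_exp_smul_sub μ hη z) (h_int.smul_const z)]
    simp only [← smul_add, sub_add_cancel]
  rw [h_grad.gradient, hm]
  dsimp only
  rw [h_split, smul_add, inv_smul_smul₀ h_pos.ne', add_sub_cancel_right, smul_comm,
    smul_inv_smul₀ (by positivity)]
end
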